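/- For a, b, c, d ∈ ℝ define on functions f : ℝ → ℝ the operators τ = 2L, τ^{(a,b,c,d)*} = μ₁L + μ₂M₁ + μ₃M₂ + μ₄R₁ + μ₅R₂ with μ₁ = ½(1−(a+b+c+d)) + (ab+cd), μ₂ = ½(a+b−c−d) − (ab−cd), μ₃ = ½(c+d−a−b), μ₄ = −¼, μ₅ = ½(a+b+c+d) − ¾, the contiguity operators μ^{(a,b,c,d)} = (d−a)L + (a+d−1)M₁ + M₂ and μ^{(a,b,c,d)*} = (c−b)L + (b+c−1)M₁ + M₂, and the Continuous Hahn difference operator (𝒟f)(x) = B̃(x)f(x+2) − [B̃(x)+D̃(x)]f(x) + D̃(x)f(x−2) with B̃(x) = (c+x/2)(d+x/2) and D̃(x) = (a−x/2)(b−x/2). Then the following four factorization identities hold as operator identities: 𝒟 = μ^{(a+½,b−½,c−½,d+½)} μ^{(a,b,c,d)*} − (a+d)(b+c−1); 𝒟 = μ^{(a−½,b+½,c+½,d−½)*} μ^{(a,b,c,d)} − (a+d−1)(b+c); 𝒟 = τ^{(a+½,b+½,c+½,d+½)*} τ; and 𝒟 = τ τ^{(a,b,c,d)*} + 2 − (a+b+c+d).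 -/

import Mathlib

/-- Lowering S-Heun operator `L = ½(T₊ − T₋)` on the discrete linear grid. -/
noncomputable def opL (f : ℝ → ℝ) : ℝ → ℝ := fun x => (f (x+1) - f (x-1)) / 2
/-- Stabilizing S-Heun operator `M₁ = ½(T₊ + T₋)`. -/
noncomputable def opM1 (f : ℝ → ℝ) : ℝ → ℝ := fun x => (f (x+1) + f (x-1)) / 2
/-- Stabilizing S-Heun operator `M₂ = ½ x (T₊ − T₋)`. -/
noncomputable def opM2 (f : ℝ → ℝ) : ℝ → ℝ := fun x => x * (f (x+1) - f (x-1)) / 2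
/-- Raising S-Heun operator `R₁ = ½ x [(1−2x)T₊ + (1+2x)T₋]`. -/
noncomputable def opR1 (f : ℝ → ℝ) : ℝ → ℝ :=
  fun x => x * ((1 - 2*x) * f (x+1) + (1 + 2*x) * f (x-1)) / 2
/-- Raising S-Heun operator `R₂ = ½ x (T₊ + T₋)`. -/
noncomputable def opR2 (f : ℝ → ℝ) : ℝ → ℝ := fun x => x * (f (x+1) + f (x-1)) / 2

/-- The forward operator `τ = 2L`. -/
noncomputable def tauOp (f : ℝ → ℝ) : ℝ → ℝ := fun x => 2 * opL f x

/-- The backward operator `τ^{(a,b,c,d)*} = μ₁L + μ₂M₁ + μ₃M₂ + μ₄R₁ + μ₅R₂`. -/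
noncomputable def tauS (a b c d : ℝ) (f : ℝ → ℝ) : ℝ → ℝ := fun x =>
  ((1/2)*(1-(a+b+c+d)) + (a*b+c*d)) * opL f x
  + ((1/2)*(a+b-c-d) - (a*b-c*d)) * opM1 f x
  + ((1/2)*(c+d-a-b)) * opM2 f x
  + (-(1/4)) * opR1 f x
  + ((1/2)*(a+b+c+d) - 3/4) * opR2 f x

/-- Contiguity operator `μ^{(a,b,c,d)} = (d−a)L + (a+d−1)M₁ + M₂`. -/
noncomputable def muOp (a b c d : ℝ) (f : ℝ → ℝ) : ℝ → ℝ := fun x =>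
  (d-a) * opL f x + (a+d-1) * opM1 f x + opM2 f x

/-- Contiguity operator `μ^{(a,b,c,d)*} = (c−b)L + (b+c−1)M₁ + M₂`. -/
noncomputable def muS (a b c d : ℝ) (f : ℝ → ℝ) : ℝ → ℝ := fun x =>
  (c-b) * opL f x + (b+c-1) * opM1 f x + opM2 f x

/-- The Continuous Hahn difference operator
`(𝒟f)(x) = B̃(x)f(x+2) − [B̃(x)+D̃(x)]f(x) + D̃(x)f(x−2)` with
`B̃(x) = (c+x/2)(d+x/2)`, `D̃(x) = (a−x/2)(b−x/2)`. -/
noncomputable def DCH (a b c d : ℝ) (f : ℝ → ℝ) : ℝ → ℝ := fun x =>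
  (c + x/2)*(d + x/2) * f (x+2)
  - ((c + x/2)*(d + x/2) + (a - x/2)*(b - x/2)) * f x
  + (a - x/2)*(b - x/2) * f (x-2)

/-- Four factorizations of the Continuous Hahn operator. -/
theorem stmt_9 (a b c d : ℝ) :
    (∀ (f : ℝ → ℝ) (x : ℝ), DCH a b c d f x
        = muOp (a+1/2) (b-1/2) (c-1/2) (d+1/2) (muS a b c d f) x
          - (a+d)*(b+c-1) * f x) ∧
    (∀ (f : ℝ → ℝ) (x : ℝ), DCH a b c d f x
        = muS (a-1/2) (b+1/2) (c+1/2) (d-1/2) (muOp a b c d f) x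
          - (a+d-1)*(b+c) * f x) ∧
    (∀ (f : ℝ → ℝ) (x : ℝ), DCH a b c d f x
        = tauS (a+1/2) (b+1/2) (c+1/2) (d+1/2) (tauOp f) x) ∧
    (∀ (f : ℝ → ℝ) (x : ℝ), DCH a b c d f x
        = tauOp (tauS a b c d f) x + (2 - (a+b+c+d)) * f x) := by
  have h1 : ∀ x : ℝ, x + 1 + 1 = x + 2 := fun x => by ring
  have h2 : ∀ x : ℝ, x - 1 - 1 = x - 2 := fun x => by ring
  have h3 : ∀ x : ℝ, x + 1 - 1 = x := fun x => by ring
  have h4 : ∀ x : ℝ, x - 1 + 1 = x := fun x => by ring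
  refine ⟨?_, ?_, ?_, ?_⟩ <;> intro f x <;>
    simp only [DCH, muOp, muS, tauS, tauOp, opL, opM1, opM2, opR1, opR2, h1, h2, h3, h4] <;> ring
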